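/- arXiv:2501.07915 — 2 statements merged into one kernel-verified Lean document; each statement's English description precedes it below -/
import Mathlib

section
/- Let x ∈ ℝᵈ with x ≠ 0. If the left-hand derivative of h_x at ω = 1 is strictly positive, then g(x) = h_x(1) = xᵀ (P₁ + S₁₁)⁻¹ x; moreover the infimum defining g(x) is attained at some P* ∈ 𝒜, i.e. there exists P* ∈ 𝒜 with xᵀ Hᵀ (P*)⁻¹ H x = h_x(1). -/
open Matrix Set

noncomputable section

/-- `H = [I_d; I_d]`, the two vertically stacked `d×d` identity blocks. -/
def Hmat (d : ℕ) : Matrix (Fin d ⊕ Fin d) (Fin d) ℝ :=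
  Matrix.fromRows 1 1

/-- The admissible set `𝒜`: all matrices `P⁽¹⁾ + S` with `P⁽¹⁾` positive
semidefinite with diagonal blocks `P₁` and `P₂`. -/
def Adm (d : ℕ) (P₁ P₂ : Matrix (Fin d) (Fin d) ℝ)
    (S : Matrix (Fin d ⊕ Fin d) (Fin d ⊕ Fin d) ℝ) :
    Set (Matrix (Fin d ⊕ Fin d) (Fin d ⊕ Fin d) ℝ) :=
  {P | ∃ Q : Matrix (Fin d ⊕ Fin d) (Fin d ⊕ Fin d) ℝ,
      Q.PosSemidef ∧ Q.toBlocks₁₁ = P₁ ∧ Q.toBlocks₂₂ = P₂ ∧ P = Q + S}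

/-- The ESCI centralized bound `Bc(ω) = blockdiag(ω⁻¹ P₁, (1-ω)⁻¹ P₂) + S`. -/
def Bc (d : ℕ) (P₁ P₂ : Matrix (Fin d) (Fin d) ℝ)
    (S : Matrix (Fin d ⊕ Fin d) (Fin d ⊕ Fin d) ℝ) (ω : ℝ) :
    Matrix (Fin d ⊕ Fin d) (Fin d ⊕ Fin d) ℝ :=
  Matrix.fromBlocks (ω⁻¹ • P₁) 0 0 ((1 - ω)⁻¹ • P₂) + S

/-- The fused ESCI precision matrix `A_F(ω) = Hᵀ Bc(ω)⁻¹ H`, continuously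
extended at the endpoints. -/
def AF (d : ℕ) (P₁ P₂ : Matrix (Fin d) (Fin d) ℝ)
    (S : Matrix (Fin d ⊕ Fin d) (Fin d ⊕ Fin d) ℝ) (ω : ℝ) :
    Matrix (Fin d) (Fin d) ℝ :=
  if ω = 0 then (P₂ + S.toBlocks₂₂)⁻¹
  else if ω = 1 then (P₁ + S.toBlocks₁₁)⁻¹
  else (Hmat d)ᵀ * (Bc d P₁ P₂ S ω)⁻¹ * Hmat d

/-- The fused ESCI bound `B_F(ω) = A_F(ω)⁻¹`. -/
def BF (d : ℕ) (P₁ P₂ : Matrix (Fin d) (Fin d) ℝ)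
    (S : Matrix (Fin d ⊕ Fin d) (Fin d ⊕ Fin d) ℝ) (ω : ℝ) :
    Matrix (Fin d) (Fin d) ℝ :=
  (AF d P₁ P₂ S ω)⁻¹

/-- `g(x) = inf_{P ∈ 𝒜} xᵀ Hᵀ P⁻¹ H x`. -/
def gfun (d : ℕ) (P₁ P₂ : Matrix (Fin d) (Fin d) ℝ)
    (S : Matrix (Fin d ⊕ Fin d) (Fin d ⊕ Fin d) ℝ) (x : Fin d → ℝ) : ℝ :=
  ⨅ P : (Adm d P₁ P₂ S),
    x ⬝ᵥ ((Hmat d)ᵀ * ((P : Matrix (Fin d ⊕ Fin d) (Fin d ⊕ Fin d) ℝ))⁻¹ * Hmat d) *ᵥ x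

/-- `h_x(ω) = xᵀ A_F(ω) x`. -/
def hfun (d : ℕ) (P₁ P₂ : Matrix (Fin d) (Fin d) ℝ)
    (S : Matrix (Fin d ⊕ Fin d) (Fin d ⊕ Fin d) ℝ) (x : Fin d → ℝ) (ω : ℝ) : ℝ :=
  x ⬝ᵥ (AF d P₁ P₂ S ω) *ᵥ x

theorem fromBlocks_eq_of_isHermitian {m n : Type*} {S : Matrix (m ⊕ n) (m ⊕ n) ℝ}
    (hS : S.IsHermitian) :
    fromBlocks S.toBlocks₁₁ S.toBlocks₂₁ᵀ S.toBlocks₂₁ S.toBlocks₂₂ = S := by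
  conv_rhs => rw [← fromBlocks_toBlocks S]
  congr 1
  ext i j
  simpa [toBlocks₂₁, toBlocks₁₂] using hS.apply (Sum.inl i) (Sum.inr j)

section QuadraticForms

variable {m n : Type*} [Fintype m] [Fintype n]

theorem dotProduct_mulVec_comm_of_isHermitian {M : Matrix n n ℝ} (hM : M.IsHermitian)
    (a b : n → ℝ) : a ⬝ᵥ M *ᵥ b = b ⬝ᵥ M *ᵥ a := by
  have h : Mᵀ = M := by simpa [conjTranspose_eq_transpose_of_trivial] using hM.eq
  conv_lhs => rw [← h]
  exact dotProduct_transpose_mulVec M a b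

theorem quadForm_nonneg_of_posSemidef {M : Matrix n n ℝ} (hM : M.PosSemidef) (a : n → ℝ) :
    0 ≤ a ⬝ᵥ M *ᵥ a := by
  simpa using hM.dotProduct_mulVec_nonneg a

theorem quadForm_pos_of_posDef {M : Matrix n n ℝ} (hM : M.PosDef) {a : n → ℝ} (ha : a ≠ 0) :
    0 < a ⬝ᵥ M *ᵥ a := by
  simpa using hM.dotProduct_mulVec_pos ha

theorem quadForm_add_smul {M : Matrix n n ℝ} (hM : M.IsHermitian) (a b : n → ℝ) (t : ℝ) :
    (a + t • b) ⬝ᵥ M *ᵥ (a + t • b) =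
      a ⬝ᵥ M *ᵥ a + 2 * t * (a ⬝ᵥ M *ᵥ b) + t ^ 2 * (b ⬝ᵥ M *ᵥ b) := by
  simp only [mulVec_add, mulVec_smul, add_dotProduct, dotProduct_add, smul_dotProduct,
    dotProduct_smul, smul_eq_mul, dotProduct_mulVec_comm_of_isHermitian hM b a]
  ring

theorem mulVec_inv_mulVec_of_posDef [DecidableEq n] {M : Matrix n n ℝ} (hM : M.PosDef)
    (b : n → ℝ) : M *ᵥ M⁻¹ *ᵥ b = b := by
  rw [mulVec_mulVec, mul_nonsing_inv _ ((isUnit_iff_isUnit_det M).mp hM.isUnit), one_mulVec]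

theorem inv_mulVec_mulVec_of_posDef [DecidableEq n] {M : Matrix n n ℝ} (hM : M.PosDef)
    (b : n → ℝ) : M⁻¹ *ᵥ M *ᵥ b = b := by
  rw [mulVec_mulVec, nonsing_inv_mul _ ((isUnit_iff_isUnit_det M).mp hM.isUnit), one_mulVec]

/-- The variational lower bound for the quadratic form of an inverse matrix. -/
theorem two_mul_dotProduct_sub_le_inv_quadForm [DecidableEq n] {M : Matrix n n ℝ}
    (hM : M.PosDef) (b z : n → ℝ) :
    2 * (z ⬝ᵥ b) - z ⬝ᵥ M *ᵥ z ≤ b ⬝ᵥ M⁻¹ *ᵥ b := by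
  have h := quadForm_nonneg_of_posSemidef hM.posSemidef (z + (-1 : ℝ) • M⁻¹ *ᵥ b)
  rw [quadForm_add_smul hM.isHermitian, mulVec_inv_mulVec_of_posDef hM,
    dotProduct_comm (M⁻¹ *ᵥ b) b] at h
  linarith

theorem quadForm_fromBlocks (A : Matrix m m ℝ) (B : Matrix n m ℝ) (D : Matrix n n ℝ)
    (a : m → ℝ) (b : n → ℝ) :
    Sum.elim a b ⬝ᵥ fromBlocks A Bᵀ B D *ᵥ Sum.elim a b =
      a ⬝ᵥ A *ᵥ a + 2 * (b ⬝ᵥ B *ᵥ a) + b ⬝ᵥ D *ᵥ b := by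
  simp only [fromBlocks_mulVec, Sum.elim_comp_inl, Sum.elim_comp_inr,
    sumElim_dotProduct_sumElim, dotProduct_add, dotProduct_transpose_mulVec]
  ring

theorem posSemidef_fromBlocks_of_quadForm_nonneg {A : Matrix m m ℝ} {B : Matrix n m ℝ}
    {D : Matrix n n ℝ} (hA : A.IsHermitian) (hD : D.IsHermitian)
    (h : ∀ a b, 0 ≤ a ⬝ᵥ A *ᵥ a + 2 * (b ⬝ᵥ B *ᵥ a) + b ⬝ᵥ D *ᵥ b) :
    (fromBlocks A Bᵀ B D).PosSemidef := by
  refine .of_dotProduct_mulVec_nonneg (hA.fromBlocks ?_ hD) fun z => ?_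
  · simp [conjTranspose_eq_transpose_of_trivial]
  · rw [star_trivial, ← Sum.elim_comp_inl_inr z, quadForm_fromBlocks]
    exact h _ _

/-- A rank-one choice of the off-diagonal block sending `u` to `P₂ v` gives a positive semidefinite
matrix as soon as `vᵀ P₂ v ≤ uᵀ P₁ u`. -/
theorem posSemidef_fromBlocks_vecMulVec {P₁ : Matrix m m ℝ} {P₂ : Matrix n n ℝ}
    (hP₁ : P₁.PosSemidef) (hP₂ : P₂.PosSemidef) {u : m → ℝ} {v : n → ℝ}
    (hu : 0 < u ⬝ᵥ P₁ *ᵥ u) (huv : v ⬝ᵥ P₂ *ᵥ v ≤ u ⬝ᵥ P₁ *ᵥ u) {K : Matrix n m ℝ}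
    (hK : K = (u ⬝ᵥ P₁ *ᵥ u)⁻¹ • vecMulVec (P₂ *ᵥ v) (P₁ *ᵥ u)) :
    (fromBlocks P₁ Kᵀ K P₂).PosSemidef := by
  refine posSemidef_fromBlocks_of_quadForm_nonneg hP₁.isHermitian hP₂.isHermitian fun a b => ?_
  set q := u ⬝ᵥ P₁ *ᵥ u
  set t := q⁻¹ * (a ⬝ᵥ P₁ *ᵥ u) with ht
  have hKa : b ⬝ᵥ K *ᵥ a = t * (b ⬝ᵥ P₂ *ᵥ v) := by
    rw [hK, smul_mulVec, vecMulVec_mulVec, dotProduct_comm (P₁ *ᵥ u) a]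
    simp only [dotProduct_smul, smul_eq_mul, op_smul_eq_smul, ht]
    ring
  have hqt : a ⬝ᵥ P₁ *ᵥ u = q * t := by rw [ht, mul_inv_cancel_left₀ hu.ne']
  have h₁ := quadForm_nonneg_of_posSemidef hP₁ (a + (-t) • u)
  have h₂ := quadForm_nonneg_of_posSemidef hP₂ (b + t • v)
  rw [quadForm_add_smul hP₁.isHermitian, hqt] at h₁
  rw [quadForm_add_smul hP₂.isHermitian] at h₂
  have h₃ := mul_le_mul_of_nonneg_left huv (sq_nonneg t)
  rw [hKa]
  change 0 ≤ a ⬝ᵥ P₁ *ᵥ a + 2 * (-t) * (q * t) + (-t) ^ 2 * q at h₁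
  linarith

end QuadraticForms

theorem dotProduct_Hmat_conj_mulVec {d : ℕ} (M : Matrix (Fin d ⊕ Fin d) (Fin d ⊕ Fin d) ℝ)
    (x : Fin d → ℝ) :
    x ⬝ᵥ ((Hmat d)ᵀ * M * Hmat d) *ᵥ x = Sum.elim x x ⬝ᵥ M *ᵥ Sum.elim x x := by
  have hH : Hmat d *ᵥ x = Sum.elim x x := by simp [Hmat, fromRows_mulVec]
  rw [← mulVec_mulVec, ← mulVec_mulVec, dotProduct_transpose_mulVec, hH, dotProduct_comm]

theorem posDef_Bc {d : ℕ} {P₁ P₂ : Matrix (Fin d) (Fin d) ℝ} (hP₁ : P₁.PosDef) (hP₂ : P₂.PosDef)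
    {S : Matrix (Fin d ⊕ Fin d) (Fin d ⊕ Fin d) ℝ} (hS : S.PosDef) {ω : ℝ} (h₀ : 0 < ω)
    (h₁ : ω < 1) : (Bc d P₁ P₂ S ω).PosDef := by
  have hA := hP₁.posSemidef.smul (inv_nonneg.mpr h₀.le)
  have hD := hP₂.posSemidef.smul (inv_nonneg.mpr (sub_nonneg.mpr h₁.le))
  have h : (fromBlocks (ω⁻¹ • P₁) (0 : Matrix (Fin d) (Fin d) ℝ)ᵀ 0
      ((1 - ω)⁻¹ • P₂)).PosSemidef :=
    posSemidef_fromBlocks_of_quadForm_nonneg hA.isHermitian hD.isHermitian fun a b => by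
      simpa using add_nonneg (quadForm_nonneg_of_posSemidef hA a)
        (quadForm_nonneg_of_posSemidef hD b)
  rw [transpose_zero] at h
  exact PosDef.posSemidef_add h hS

theorem le_hfun {d : ℕ} {P₁ P₂ : Matrix (Fin d) (Fin d) ℝ} (hP₁ : P₁.PosDef) (hP₂ : P₂.PosDef)
    {S : Matrix (Fin d ⊕ Fin d) (Fin d ⊕ Fin d) ℝ} (hS : S.PosDef) (x a b : Fin d → ℝ)
    {ω : ℝ} (h₀ : 0 < ω) (h₁ : ω < 1) :
    2 * (a ⬝ᵥ x + b ⬝ᵥ x) - (ω⁻¹ * (a ⬝ᵥ P₁ *ᵥ a) + (1 - ω)⁻¹ * (b ⬝ᵥ P₂ *ᵥ b)) -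
      (a ⬝ᵥ S.toBlocks₁₁ *ᵥ a + 2 * (b ⬝ᵥ S.toBlocks₂₁ *ᵥ a) + b ⬝ᵥ S.toBlocks₂₂ *ᵥ b) ≤
      hfun d P₁ P₂ S x ω := by
  have h := two_mul_dotProduct_sub_le_inv_quadForm (posDef_Bc hP₁ hP₂ hS h₀ h₁) (Sum.elim x x)
    (Sum.elim a b)
  rw [← dotProduct_Hmat_conj_mulVec] at h
  have hB : Sum.elim a b ⬝ᵥ Bc d P₁ P₂ S ω *ᵥ Sum.elim a b =
      ω⁻¹ * (a ⬝ᵥ P₁ *ᵥ a) + (1 - ω)⁻¹ * (b ⬝ᵥ P₂ *ᵥ b) +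
      (a ⬝ᵥ S.toBlocks₁₁ *ᵥ a + 2 * (b ⬝ᵥ S.toBlocks₂₁ *ᵥ a) + b ⬝ᵥ S.toBlocks₂₂ *ᵥ b) := by
    rw [← quadForm_fromBlocks, fromBlocks_eq_of_isHermitian hS.isHermitian, Bc, add_mulVec,
      dotProduct_add]
    simp [fromBlocks_mulVec, smul_mulVec]
  rw [hB, sumElim_dotProduct_sumElim] at h
  rw [hfun, AF, if_neg h₀.ne', if_neg h₁.ne]
  linarith

theorem posDef_of_mem_Adm {d : ℕ} {P₁ P₂ : Matrix (Fin d) (Fin d) ℝ}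
    {S : Matrix (Fin d ⊕ Fin d) (Fin d ⊕ Fin d) ℝ} (hS : S.PosDef)
    {P : Matrix (Fin d ⊕ Fin d) (Fin d ⊕ Fin d) ℝ} (hP : P ∈ Adm d P₁ P₂ S) : P.PosDef := by
  obtain ⟨Q, hQ, -, -, rfl⟩ := hP
  exact PosDef.posSemidef_add hQ hS

theorem posDef_add_toBlocks₁₁ {d : ℕ} {P₁ : Matrix (Fin d) (Fin d) ℝ} (hP₁ : P₁.PosDef)
    {S : Matrix (Fin d ⊕ Fin d) (Fin d ⊕ Fin d) ℝ} (hS : S.PosDef) :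
    (P₁ + S.toBlocks₁₁).PosDef :=
  hP₁.add_posSemidef (hS.posSemidef.submatrix Sum.inl)

theorem hfun_one (d : ℕ) (P₁ P₂ : Matrix (Fin d) (Fin d) ℝ)
    (S : Matrix (Fin d ⊕ Fin d) (Fin d ⊕ Fin d) ℝ) (x : Fin d → ℝ) :
    hfun d P₁ P₂ S x 1 = x ⬝ᵥ (P₁ + S.toBlocks₁₁)⁻¹ *ᵥ x := by
  simp [hfun, AF]

theorem hfun_one_le_of_mem_Adm {d : ℕ} {P₁ P₂ : Matrix (Fin d) (Fin d) ℝ} (hP₁ : P₁.PosDef)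
    {S : Matrix (Fin d ⊕ Fin d) (Fin d ⊕ Fin d) ℝ} (hS : S.PosDef) (x : Fin d → ℝ)
    {P : Matrix (Fin d ⊕ Fin d) (Fin d ⊕ Fin d) ℝ} (hP : P ∈ Adm d P₁ P₂ S) :
    hfun d P₁ P₂ S x 1 ≤ x ⬝ᵥ ((Hmat d)ᵀ * P⁻¹ * Hmat d) *ᵥ x := by
  have hPd := posDef_of_mem_Adm hS hP
  have hA : P.toBlocks₁₁ = P₁ + S.toBlocks₁₁ := by
    obtain ⟨Q, -, rfl, -, rfl⟩ := hP
    rfl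
  set u := (P₁ + S.toBlocks₁₁)⁻¹ *ᵥ x with hu
  have h := two_mul_dotProduct_sub_le_inv_quadForm hPd (Sum.elim x x) (Sum.elim u 0)
  rw [← dotProduct_Hmat_conj_mulVec, ← fromBlocks_eq_of_isHermitian hPd.isHermitian,
    quadForm_fromBlocks, fromBlocks_eq_of_isHermitian hPd.isHermitian, hA,
    sumElim_dotProduct_sumElim, hu,
    mulVec_inv_mulVec_of_posDef (posDef_add_toBlocks₁₁ hP₁ hS), ← hu] at h
  simp only [zero_dotProduct] at h
  rw [hfun_one, ← hu, dotProduct_comm]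
  linarith

/-- The left-hand derivative of `h_x` at `1` is at most `uᵀ P₁ u - vᵀ P₂ v`, where
`u = (P₁ + S₁₁)⁻¹ x` and `v = P₂⁻¹ (x - S₂₁ u)`. -/
theorem deriv_hfun_one_le {d : ℕ} {P₁ P₂ : Matrix (Fin d) (Fin d) ℝ} (hP₁ : P₁.PosDef)
    (hP₂ : P₂.PosDef) {S : Matrix (Fin d ⊕ Fin d) (Fin d ⊕ Fin d) ℝ} (hS : S.PosDef)
    {x u v : Fin d → ℝ} (hu : (P₁ + S.toBlocks₁₁) *ᵥ u = x)
    (hv : P₂ *ᵥ v = x - S.toBlocks₂₁ *ᵥ u) {c : ℝ}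
    (hder : HasDerivWithinAt (hfun d P₁ P₂ S x) c (Set.Icc (0 : ℝ) 1) 1) :
    c ≤ u ⬝ᵥ P₁ *ᵥ u - v ⬝ᵥ P₂ *ᵥ v := by
  have hslope := (hasDerivWithinAt_iff_tendsto_slope' (by simp)).mp
    (hder.mono Ioo_subset_Icc_self)
  set s := v ⬝ᵥ S.toBlocks₂₂ *ᵥ v
  have hlim : Filter.Tendsto
      (fun ω : ℝ => ω⁻¹ * (u ⬝ᵥ P₁ *ᵥ u) - v ⬝ᵥ P₂ *ᵥ v + (1 - ω) * s)
      (nhdsWithin 1 (Ioo 0 1)) (nhds (u ⬝ᵥ P₁ *ᵥ u - v ⬝ᵥ P₂ *ᵥ v)) := by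
    have hc : ContinuousAt
        (fun ω : ℝ => ω⁻¹ * (u ⬝ᵥ P₁ *ᵥ u) - v ⬝ᵥ P₂ *ᵥ v + (1 - ω) * s) 1 := by
      fun_prop (disch := norm_num)
    simpa using hc.tendsto.mono_left (nhdsWithin_le_nhds (s := Ioo (0 : ℝ) 1))
  have : (nhdsWithin (1 : ℝ) (Ioo 0 1)).NeBot := right_nhdsWithin_Ioo_neBot one_pos
  refine le_of_tendsto_of_tendsto hslope hlim ?_
  filter_upwards [self_mem_nhdsWithin] with ω ⟨h₀, h₁⟩
  have hδ : 0 < 1 - ω := sub_pos.mpr h₁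
  have hle := le_hfun hP₁ hP₂ hS x u ((1 - ω) • v) h₀ h₁
  have hvx : v ⬝ᵥ x = v ⬝ᵥ P₂ *ᵥ v + v ⬝ᵥ S.toBlocks₂₁ *ᵥ u := by
    rw [← dotProduct_add, hv, sub_add_cancel]
  have hux : u ⬝ᵥ x = u ⬝ᵥ P₁ *ᵥ u + u ⬝ᵥ S.toBlocks₁₁ *ᵥ u := by
    rw [← dotProduct_add, ← add_mulVec, hu]
  have h1 : hfun d P₁ P₂ S x 1 = u ⬝ᵥ x := by
    rw [hfun_one, dotProduct_comm u x]
    conv_lhs => rw [← hu, inv_mulVec_mulVec_of_posDef (posDef_add_toBlocks₁₁ hP₁ hS)]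
    rw [hu]
  simp only [smul_dotProduct, mulVec_smul, dotProduct_smul, smul_eq_mul,
    inv_mul_cancel_left₀ hδ.ne', hvx, hux] at hle
  have hω : ω⁻¹ - 1 = (1 - ω) * ω⁻¹ := by field_simp
  have hslope_eq : slope (hfun d P₁ P₂ S x) 1 ω =
      (u ⬝ᵥ x - hfun d P₁ P₂ S x ω) / (1 - ω) := by
    rw [slope_def_field, h1, ← neg_sub (u ⬝ᵥ x), ← neg_sub 1 ω, neg_div_neg_eq]
  rw [hslope_eq, div_le_iff₀ hδ, hux]
  linear_combination hle + (u ⬝ᵥ P₁ *ᵥ u) * hω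

theorem exists_mem_Adm_eq {d : ℕ} {P₁ P₂ : Matrix (Fin d) (Fin d) ℝ} (hP₁ : P₁.PosDef)
    (hP₂ : P₂.PosDef) {S : Matrix (Fin d ⊕ Fin d) (Fin d ⊕ Fin d) ℝ} (hS : S.PosDef)
    {x u v : Fin d → ℝ} (hu : (P₁ + S.toBlocks₁₁) *ᵥ u = x)
    (hv : P₂ *ᵥ v = x - S.toBlocks₂₁ *ᵥ u) (hu₀ : u ≠ 0)
    (huv : v ⬝ᵥ P₂ *ᵥ v ≤ u ⬝ᵥ P₁ *ᵥ u) :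
    ∃ P ∈ Adm d P₁ P₂ S, x ⬝ᵥ ((Hmat d)ᵀ * P⁻¹ * Hmat d) *ᵥ x = x ⬝ᵥ u := by
  have hq : 0 < u ⬝ᵥ P₁ *ᵥ u := quadForm_pos_of_posDef hP₁ hu₀
  set K := (u ⬝ᵥ P₁ *ᵥ u)⁻¹ • vecMulVec (P₂ *ᵥ v) (P₁ *ᵥ u) with hK
  have hKu : K *ᵥ u = P₂ *ᵥ v := by
    rw [hK, smul_mulVec, vecMulVec_mulVec, op_smul_eq_smul, dotProduct_comm (P₁ *ᵥ u) u, smul_smul,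
      inv_mul_cancel₀ hq.ne', one_smul]
  have hmem : fromBlocks P₁ Kᵀ K P₂ + S ∈ Adm d P₁ P₂ S :=
    ⟨_, posSemidef_fromBlocks_vecMulVec hP₁.posSemidef hP₂.posSemidef hq huv hK, by simp,
      by simp, rfl⟩
  refine ⟨_, hmem, ?_⟩
  have hsolve : (fromBlocks P₁ Kᵀ K P₂ + S) *ᵥ Sum.elim u 0 = Sum.elim x x := by
    rw [← fromBlocks_toBlocks S, fromBlocks_add, fromBlocks_mulVec]
    simp [add_mulVec K, hKu, hv, hu]
  rw [dotProduct_Hmat_conj_mulVec]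
  nth_rw 2 [← hsolve]
  rw [inv_mulVec_mulVec_of_posDef (posDef_of_mem_Adm hS hmem), sumElim_dotProduct_sumElim]
  simp

/-- if the left-hand derivative of `h_x` at `ω = 1` is strictly
positive, then `g(x) = h_x(1) = xᵀ (P₁ + S₁₁)⁻¹ x`, and the infimum defining
`g(x)` is attained at some `P* ∈ 𝒜`. -/
theorem gfun_eq_hfun_one_of_deriv_pos (d : ℕ) (hd : 1 ≤ d)
    (P₁ P₂ : Matrix (Fin d) (Fin d) ℝ) (hP₁ : P₁.PosDef) (hP₂ : P₂.PosDef)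
    (S : Matrix (Fin d ⊕ Fin d) (Fin d ⊕ Fin d) ℝ) (hS : S.PosDef)
    (x : Fin d → ℝ) (hx : x ≠ 0) (c : ℝ)
    (hder : HasDerivWithinAt (hfun d P₁ P₂ S x) c (Set.Icc (0 : ℝ) 1) 1)
    (hpos : 0 < c) :
    gfun d P₁ P₂ S x = hfun d P₁ P₂ S x 1 ∧
    hfun d P₁ P₂ S x 1 = x ⬝ᵥ (P₁ + S.toBlocks₁₁)⁻¹ *ᵥ x ∧
    ∃ P ∈ Adm d P₁ P₂ S,
      x ⬝ᵥ ((Hmat d)ᵀ * P⁻¹ * Hmat d) *ᵥ x = hfun d P₁ P₂ S x 1 := by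
  set u := (P₁ + S.toBlocks₁₁)⁻¹ *ᵥ x with hu_def
  have hu : (P₁ + S.toBlocks₁₁) *ᵥ u = x :=
    mulVec_inv_mulVec_of_posDef (posDef_add_toBlocks₁₁ hP₁ hS) x
  have hv := mulVec_inv_mulVec_of_posDef hP₂ (x - S.toBlocks₂₁ *ᵥ u)
  have hu₀ : u ≠ 0 := fun h => hx (by rw [← hu, h, mulVec_zero])
  have hc := deriv_hfun_one_le hP₁ hP₂ hS hu hv hder
  obtain ⟨P, hP, hPx⟩ := exists_mem_Adm_eq hP₁ hP₂ hS hu hv hu₀ (by linarith)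
  have hone := hfun_one d P₁ P₂ S x
  rw [hu_def, ← hone] at hPx
  refine ⟨?_, hone, P, hP, hPx⟩
  have : Nonempty (Adm d P₁ P₂ S) := ⟨⟨P, hP⟩⟩
  refine le_antisymm ?_ (le_ciInf fun R => hfun_one_le_of_mem_Adm hP₁ hS x R.2)
  rw [← hPx]
  exact ciInf_le ⟨_, forall_mem_range.mpr fun R => hfun_one_le_of_mem_Adm hP₁ hS x R.2⟩
    (⟨P, hP⟩ : Adm d P₁ P₂ S)
end
end

section
/- For every conservative fusion (K, B) over 𝒜, there exists ω₁ ∈ [0,1] such that B_F(ω₁) ⪯ B. -/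
open Matrix Set

noncomputable section

/-- A pair `(K, B)` is a conservative fusion over `𝒜`:
`B` is symmetric, `K H = I` and `K P Kᵀ ⪯ B` for every `P ∈ 𝒜`. -/
def ConsFusion (d : ℕ) (P₁ P₂ : Matrix (Fin d) (Fin d) ℝ)
    (S : Matrix (Fin d ⊕ Fin d) (Fin d ⊕ Fin d) ℝ)
    (K : Matrix (Fin d) (Fin d ⊕ Fin d) ℝ) (B : Matrix (Fin d) (Fin d) ℝ) : Prop :=
  B.IsSymm ∧ K * Hmat d = 1 ∧ ∀ P ∈ Adm d P₁ P₂ S, (B - K * P * Kᵀ).PosSemidef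

section QuadraticForm

variable {V : Type*} [AddCommGroup V] [Module ℝ V]

theorem QuadraticForm.apply_smul_add_smul (q : QuadraticForm ℝ V) (s t : ℝ) (x y : V) :
    q (s • x + t • y) = s ^ 2 * q x + t ^ 2 * q y + s * t * QuadraticMap.polar q x y := by
  rw [QuadraticMap.map_add q, QuadraticMap.map_smul, QuadraticMap.map_smul,
    QuadraticMap.polar_smul_left, QuadraticMap.polar_smul_right]
  simp only [smul_eq_mul]
  ring

/-- If at every point one of the forms `a`, `b` is nonnegative, then on the set where a third form
`q` is negative, points with `0 ≤ a` and points with `0 ≤ b` can only coexist if some point has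
both. -/
theorem QuadraticForm.exists_neg_and_nonneg_and_nonneg (a b q : QuadraticForm ℝ V)
    (h : ∀ z, 0 ≤ a z ∨ 0 ≤ b z) {x y : V} (hqx : q x < 0) (hqy : q y < 0)
    (hax : 0 ≤ a x) (hby : 0 ≤ b y) : ∃ z, q z < 0 ∧ 0 ≤ a z ∧ 0 ≤ b z := by
  wlog hp : QuadraticMap.polar q x y ≤ 0 generalizing y
  · refine this (y := -y) (by simpa using hqy) (by simpa using hby) ?_
    rw [QuadraticMap.polar_neg_right]
    linarith
  have hcont : ∀ c : QuadraticForm ℝ V, Continuous fun t : ℝ ↦ c ((1 - t) • x + t • y) := by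
    intro c
    simp only [QuadraticForm.apply_smul_add_smul]
    fun_prop
  obtain ⟨t, ⟨ht0, ht1⟩, hta, htb⟩ := isPreconnected_closed_iff.1
    (isPreconnected_Icc (a := (0 : ℝ)) (b := 1))
    {t | 0 ≤ a ((1 - t) • x + t • y)} {t | 0 ≤ b ((1 - t) • x + t • y)}
    (isClosed_le continuous_const (hcont a)) (isClosed_le continuous_const (hcont b))
    (fun t _ ↦ h _) ⟨0, by simp, by simpa using hax⟩ ⟨1, by simp, by simpa using hby⟩
  refine ⟨_, ?_, hta, htb⟩
  rw [QuadraticForm.apply_smul_add_smul]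
  have hst : (1 - t) * t * QuadraticMap.polar q x y ≤ 0 :=
    mul_nonpos_of_nonneg_of_nonpos (mul_nonneg (by linarith) ht0) hp
  rcases ht0.eq_or_lt with rfl | ht
  · simpa using hqx
  · nlinarith [mul_pos_of_neg_of_neg hqy (neg_neg_of_pos (pow_pos ht 2)),
      mul_nonneg (sq_nonneg (1 - t)) (neg_nonneg.2 hqx.le)]

/-- Yuan's lemma, a form of the S-lemma: if the maximum of two real quadratic forms is nonnegative,
then so is some convex combination of them. -/
theorem QuadraticForm.exists_convexCombination_nonneg (a b : QuadraticForm ℝ V)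
    (h : ∀ z, 0 ≤ a z ∨ 0 ≤ b z) :
    ∃ ω ∈ Set.Icc (0 : ℝ) 1, ∀ z, 0 ≤ ω * a z + (1 - ω) * b z := by
  have key : ∀ x y, b x < 0 → a y < 0 → -b x / (a x - b x) ≤ b y / (b y - a y) := by
    intro x y hbx hay
    have hax : 0 ≤ a x := (h x).resolve_right hbx.not_ge
    have hby : 0 ≤ b y := (h y).resolve_left hay.not_ge
    by_contra! hlt
    obtain ⟨ω, hyω, hωx⟩ := exists_between hlt
    rw [lt_div_iff₀ (by linarith)] at hωx
    rw [div_lt_iff₀ (by linarith)] at hyω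
    have hω0 : 0 ≤ ω := by
      by_contra! hneg
      nlinarith
    have hω1 : ω ≤ 1 := by
      by_contra! hneg
      nlinarith
    obtain ⟨z, hqz, haz, hbz⟩ := QuadraticForm.exists_neg_and_nonneg_and_nonneg a b
      (ω • a + (1 - ω) • b) h (x := x) (y := y)
      (by simp only [_root_.add_apply, _root_.smul_apply, smul_eq_mul]; linarith)
      (by simp only [_root_.add_apply, _root_.smul_apply, smul_eq_mul]; linarith)
      hax hby
    simp only [_root_.add_apply, _root_.smul_apply, smul_eq_mul] at hqz
    nlinarith [mul_nonneg hω0 haz, mul_nonneg (sub_nonneg.2 hω1) hbz]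
  by_cases hb : ∀ z, 0 ≤ b z
  · exact ⟨0, by simp, by simpa using hb⟩
  by_cases ha : ∀ z, 0 ≤ a z
  · exact ⟨1, by simp, by simpa using ha⟩
  push Not at ha hb
  obtain ⟨x₀, hx₀⟩ := hb
  obtain ⟨y₀, hy₀⟩ := ha
  set L : Set ℝ := (fun x ↦ -b x / (a x - b x)) '' {x | b x < 0} with hL
  have hle : ∀ x, b x < 0 → -b x / (a x - b x) ≤ sSup L := fun x hx ↦
    le_csSup ⟨b y₀ / (b y₀ - a y₀), by rintro _ ⟨x, hx, rfl⟩; exact key x y₀ hx hy₀⟩ ⟨x, hx, rfl⟩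
  have hge : ∀ y, a y < 0 → sSup L ≤ b y / (b y - a y) := fun y hy ↦
    csSup_le ⟨_, x₀, hx₀, rfl⟩ (by rintro _ ⟨x, hx, rfl⟩; exact key x y hx hy)
  have h0 : 0 ≤ sSup L := by
    have hax₀ := (h x₀).resolve_right hx₀.not_ge
    exact (div_nonneg (by linarith) (by linarith)).trans (hle x₀ hx₀)
  have h1 : sSup L ≤ 1 := by
    have hby₀ := (h y₀).resolve_left hy₀.not_ge
    exact (hge y₀ hy₀).trans (div_le_one_of_le₀ (by linarith) (by linarith))
  refine ⟨sSup L, ⟨h0, h1⟩, fun z ↦ ?_⟩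
  rcases lt_or_ge (b z) 0 with hbz | hbz
  · have haz := (h z).resolve_right hbz.not_ge
    have := hle z hbz
    rw [div_le_iff₀ (by linarith)] at this
    linarith
  rcases lt_or_ge (a z) 0 with haz | haz
  · have := hge z haz
    rw [le_div_iff₀ (by linarith)] at this
    linarith
  · exact add_nonneg (mul_nonneg h0 haz) (mul_nonneg (sub_nonneg.2 h1) hbz)

end QuadraticForm

section BlockDiagonal

variable {n : Type*} [Fintype n]

theorem Matrix.dotProduct_fromBlocks_diag_mulVec (A D : Matrix n n ℝ) (w : n ⊕ n → ℝ) :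
    w ⬝ᵥ fromBlocks A 0 0 D *ᵥ w =
      (w ∘ Sum.inl) ⬝ᵥ A *ᵥ (w ∘ Sum.inl) + (w ∘ Sum.inr) ⬝ᵥ D *ᵥ (w ∘ Sum.inr) := by
  simp [fromBlocks_mulVec, dotProduct, Fintype.sum_sum_type]

theorem Matrix.PosSemidef.fromBlocks_diag {A D : Matrix n n ℝ} (hA : A.PosSemidef)
    (hD : D.PosSemidef) : (fromBlocks A 0 0 D).PosSemidef := by
  refine .of_dotProduct_mulVec_nonneg
    (hA.isHermitian.fromBlocks (conjTranspose_zero) hD.isHermitian) fun w ↦ ?_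
  rw [star_trivial, dotProduct_fromBlocks_diag_mulVec]
  exact add_nonneg (hA.dotProduct_mulVec_nonneg _) (hD.dotProduct_mulVec_nonneg _)

theorem Matrix.IsHermitian.dotProduct_mulVec_comm {P : Matrix n n ℝ} (hP : P.IsHermitian)
    (x y : n → ℝ) : x ⬝ᵥ P *ᵥ y = y ⬝ᵥ P *ᵥ x := by
  have hT : Pᵀ = P := by simpa using hP.eq
  rw [dotProduct_mulVec, ← mulVec_transpose, hT, dotProduct_comm]

/-- Weighted Young inequality for the quadratic form of a positive semidefinite matrix. -/
theorem Matrix.PosSemidef.two_mul_dotProduct_mulVec_le {P : Matrix n n ℝ} (hP : P.PosSemidef)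
    (s : ℝ) (x y : n → ℝ) :
    2 * s * (x ⬝ᵥ P *ᵥ y) ≤ x ⬝ᵥ P *ᵥ x + s ^ 2 * (y ⬝ᵥ P *ᵥ y) := by
  have h := hP.dotProduct_mulVec_nonneg (x - s • y)
  simp only [star_trivial, mulVec_sub, mulVec_smul, dotProduct_sub, sub_dotProduct,
    smul_dotProduct, dotProduct_smul, smul_eq_mul] at h
  rw [hP.isHermitian.dotProduct_mulVec_comm y x] at h
  linarith

theorem Matrix.dotProduct_vecMulVec_self_mulVec (w y : n → ℝ) :
    w ⬝ᵥ vecMulVec y y *ᵥ w = (w ⬝ᵥ y) ^ 2 := by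
  rw [vecMulVec_mulVec]
  simp [dotProduct_smul, dotProduct_comm y w, sq]

variable [DecidableEq n]

theorem Matrix.PosDef.mul_inv {P : Matrix n n ℝ} (hP : P.PosDef) : P * P⁻¹ = 1 :=
  mul_nonsing_inv _ ((isUnit_iff_isUnit_det _).1 hP.isUnit)

theorem Matrix.PosDef.inv_mul {P : Matrix n n ℝ} (hP : P.PosDef) : P⁻¹ * P = 1 :=
  nonsing_inv_mul _ ((isUnit_iff_isUnit_det _).1 hP.isUnit)

theorem Matrix.PosDef.sub_smul_vecMulVec_posSemidef {P : Matrix n n ℝ} (hP : P.PosDef)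
    {y : n → ℝ} {c : ℝ} (hc : 0 < c) (hy : y ⬝ᵥ P⁻¹ *ᵥ y ≤ c) :
    (P - c⁻¹ • vecMulVec y y).PosSemidef := by
  have hV : (vecMulVec y y).PosSemidef := by simpa using posSemidef_vecMulVec_self_star y
  refine .of_dotProduct_mulVec_nonneg
    (hP.isHermitian.sub (hV.smul (inv_nonneg.2 hc.le)).isHermitian) fun v ↦ ?_
  have h := hP.posSemidef.two_mul_dotProduct_mulVec_le (c⁻¹ * (v ⬝ᵥ y)) v (P⁻¹ *ᵥ y)
  rw [mulVec_mulVec, hP.mul_inv, one_mulVec, dotProduct_comm (P⁻¹ *ᵥ y) y] at h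
  rw [star_trivial, sub_mulVec, dotProduct_sub, smul_mulVec, dotProduct_smul,
    dotProduct_vecMulVec_self_mulVec, smul_eq_mul]
  have h2 : (c⁻¹ * (v ⬝ᵥ y)) ^ 2 * (y ⬝ᵥ P⁻¹ *ᵥ y) ≤ (c⁻¹ * (v ⬝ᵥ y)) ^ 2 * c :=
    mul_le_mul_of_nonneg_left hy (sq_nonneg _)
  have h3 : (c⁻¹ * (v ⬝ᵥ y)) ^ 2 * c = c⁻¹ * (v ⬝ᵥ y) ^ 2 := by
    field_simp
  nlinarith

/-- A correlation that is extremal for the stacked vector `y`: the positive semidefinite matrix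
`Q` has the prescribed diagonal blocks and dominates `c⁻¹ y yᵀ`. -/
theorem Matrix.exists_posSemidef_toBlocks_le {P₁ P₂ : Matrix n n ℝ} (hP₁ : P₁.PosDef)
    (hP₂ : P₂.PosDef) {y : n ⊕ n → ℝ} {c : ℝ} (hc : 0 < c)
    (h₁ : (y ∘ Sum.inl) ⬝ᵥ P₁⁻¹ *ᵥ (y ∘ Sum.inl) ≤ c)
    (h₂ : (y ∘ Sum.inr) ⬝ᵥ P₂⁻¹ *ᵥ (y ∘ Sum.inr) ≤ c) :
    ∃ Q : Matrix (n ⊕ n) (n ⊕ n) ℝ, Q.PosSemidef ∧ Q.toBlocks₁₁ = P₁ ∧ Q.toBlocks₂₂ = P₂ ∧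
      ∀ w : n ⊕ n → ℝ, 2 * (w ⬝ᵥ y) - c ≤ w ⬝ᵥ Q *ᵥ w := by
  have hV : (vecMulVec y y).PosSemidef := by simpa using posSemidef_vecMulVec_self_star y
  have hD := (hP₁.sub_smul_vecMulVec_posSemidef hc h₁).fromBlocks_diag
    (hP₂.sub_smul_vecMulVec_posSemidef hc h₂)
  refine ⟨_, (hV.smul (inv_nonneg.2 hc.le)).add hD, ?_, ?_, fun w ↦ ?_⟩
  · ext i j
    simp [toBlocks₁₁, vecMulVec_apply]
  · ext i j
    simp [toBlocks₂₂, vecMulVec_apply]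
  · have h := hD.dotProduct_mulVec_nonneg w
    rw [star_trivial] at h
    rw [add_mulVec, dotProduct_add, smul_mulVec, dotProduct_smul,
      dotProduct_vecMulVec_self_mulVec, smul_eq_mul]
    have h2 : c⁻¹ * (w ⬝ᵥ y) ^ 2 - (2 * (w ⬝ᵥ y) - c) = c⁻¹ * (w ⬝ᵥ y - c) ^ 2 := by
      field_simp
      ring
    have h3 : 0 ≤ c⁻¹ * (w ⬝ᵥ y - c) ^ 2 := mul_nonneg (inv_nonneg.2 hc.le) (sq_nonneg _)
    linarith

end BlockDiagonal

theorem Hmat_mulVec (d : ℕ) (x : Fin d → ℝ) : Hmat d *ᵥ x = Sum.elim x x := by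
  simp [Hmat, fromRows_mulVec]

theorem Hmat_mulVec_injective (d : ℕ) : Function.Injective (Hmat d).mulVec := fun x y h ↦ by
  simpa [Hmat_mulVec] using congrArg (· ∘ Sum.inl) h

/-- The objective obtained from a conservative fusion is bounded below by the larger of the two
local costs. -/
theorem ConsFusion.nonneg_add {d : ℕ} {P₁ P₂ : Matrix (Fin d) (Fin d) ℝ} (hP₁ : P₁.PosDef)
    (hP₂ : P₂.PosDef) {S : Matrix (Fin d ⊕ Fin d) (Fin d ⊕ Fin d) ℝ} (hS : S.PosDef)
    {K : Matrix (Fin d) (Fin d ⊕ Fin d) ℝ} {B : Matrix (Fin d) (Fin d) ℝ}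
    (hKB : ConsFusion d P₁ P₂ S K B) (x u : Fin d → ℝ) (w : Fin d ⊕ Fin d → ℝ) {c : ℝ}
    (h₁ : (x - (S *ᵥ w) ∘ Sum.inl) ⬝ᵥ P₁⁻¹ *ᵥ (x - (S *ᵥ w) ∘ Sum.inl) ≤ c)
    (h₂ : (x - (S *ᵥ w) ∘ Sum.inr) ⬝ᵥ P₂⁻¹ *ᵥ (x - (S *ᵥ w) ∘ Sum.inr) ≤ c) :
    0 ≤ c + (w ⬝ᵥ S *ᵥ w - 2 * (u ⬝ᵥ x) + u ⬝ᵥ B *ᵥ u) := by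
  refine le_of_forall_pos_le_add fun ε hε ↦ ?_
  have hc : 0 ≤ c := (hP₁.inv.posSemidef.dotProduct_mulVec_nonneg _).trans h₁
  obtain ⟨Q, hQ, hQ₁, hQ₂, hQy⟩ := exists_posSemidef_toBlocks_le hP₁ hP₂
    (y := Hmat d *ᵥ x - S *ᵥ w) (c := c + ε) (by linarith)
    (by rw [Hmat_mulVec]; exact h₁.trans (by linarith))
    (by rw [Hmat_mulVec]; exact h₂.trans (by linarith))
  have hB := (hKB.2.2 (Q + S) ⟨Q, hQ, hQ₁, hQ₂, rfl⟩).dotProduct_mulVec_nonneg u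
  have hK : u ⬝ᵥ (K * (Q + S) * Kᵀ) *ᵥ u = (Kᵀ *ᵥ u) ⬝ᵥ (Q + S) *ᵥ (Kᵀ *ᵥ u) := by
    rw [← mulVec_mulVec, ← mulVec_mulVec, dotProduct_mulVec, ← mulVec_transpose]
  have hH : (Kᵀ *ᵥ u) ⬝ᵥ Hmat d *ᵥ x = u ⬝ᵥ x := by
    rw [mulVec_transpose, ← dotProduct_mulVec, mulVec_mulVec, hKB.2.1, one_mulVec]
  rw [star_trivial, sub_mulVec, dotProduct_sub, hK, add_mulVec, dotProduct_add] at hB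
  have hy := hQy (Kᵀ *ᵥ u)
  rw [dotProduct_sub, hH] at hy
  have hs := hS.posSemidef.two_mul_dotProduct_mulVec_le 1 (Kᵀ *ᵥ u) w
  linarith

/-- The weight produced by the S-lemma from a conservative fusion. -/
theorem ConsFusion.exists_weight {d : ℕ} {P₁ P₂ : Matrix (Fin d) (Fin d) ℝ} (hP₁ : P₁.PosDef)
    (hP₂ : P₂.PosDef) {S : Matrix (Fin d ⊕ Fin d) (Fin d ⊕ Fin d) ℝ} (hS : S.PosDef)
    {K : Matrix (Fin d) (Fin d ⊕ Fin d) ℝ} {B : Matrix (Fin d) (Fin d) ℝ}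
    (hKB : ConsFusion d P₁ P₂ S K B) :
    ∃ ω ∈ Set.Icc (0 : ℝ) 1, ∀ (x u : Fin d → ℝ) (w : Fin d ⊕ Fin d → ℝ),
      0 ≤ ω * ((x - (S *ᵥ w) ∘ Sum.inl) ⬝ᵥ P₁⁻¹ *ᵥ (x - (S *ᵥ w) ∘ Sum.inl)) +
        (1 - ω) * ((x - (S *ᵥ w) ∘ Sum.inr) ⬝ᵥ P₂⁻¹ *ᵥ (x - (S *ᵥ w) ∘ Sum.inr)) +
        (w ⬝ᵥ S *ᵥ w - 2 * (u ⬝ᵥ x) + u ⬝ᵥ B *ᵥ u) := by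
  let X : ((Fin d → ℝ) × (Fin d → ℝ) × (Fin d ⊕ Fin d → ℝ)) →ₗ[ℝ] (Fin d → ℝ) :=
    LinearMap.fst ℝ _ _
  let U : ((Fin d → ℝ) × (Fin d → ℝ) × (Fin d ⊕ Fin d → ℝ)) →ₗ[ℝ] (Fin d → ℝ) :=
    LinearMap.fst ℝ _ _ ∘ₗ LinearMap.snd ℝ _ _
  let W : ((Fin d → ℝ) × (Fin d → ℝ) × (Fin d ⊕ Fin d → ℝ)) →ₗ[ℝ] (Fin d ⊕ Fin d → ℝ) :=
    LinearMap.snd ℝ _ _ ∘ₗ LinearMap.snd ℝ _ _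
  let r : QuadraticForm ℝ ((Fin d → ℝ) × (Fin d → ℝ) × (Fin d ⊕ Fin d → ℝ)) :=
    S.toQuadraticForm'.comp W
      - (2 : ℝ) • LinearMap.BilinMap.toQuadraticMap ((dotProductBilin ℝ ℝ).compl₁₂ U X)
      + B.toQuadraticForm'.comp U
  let a := P₁⁻¹.toQuadraticForm'.comp
    (X - LinearMap.funLeft ℝ ℝ Sum.inl ∘ₗ S.mulVecLin ∘ₗ W) + r
  let b := P₂⁻¹.toQuadraticForm'.comp
    (X - LinearMap.funLeft ℝ ℝ Sum.inr ∘ₗ S.mulVecLin ∘ₗ W) + r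
  have hr : ∀ x u w, r (x, u, w) = w ⬝ᵥ S *ᵥ w - 2 * (u ⬝ᵥ x) + u ⬝ᵥ B *ᵥ u := fun x u w ↦ by
    simp [r, X, U, W, toQuadraticForm', toLinearMap₂'_apply', dotProductBilin]
  have ha : ∀ x u w, a (x, u, w) =
      (x - (S *ᵥ w) ∘ Sum.inl) ⬝ᵥ P₁⁻¹ *ᵥ (x - (S *ᵥ w) ∘ Sum.inl) + r (x, u, w) :=
    fun x u w ↦ by
      simp [a, X, W, toQuadraticForm', toLinearMap₂'_apply', LinearMap.funLeft]
  have hb : ∀ x u w, b (x, u, w) =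
      (x - (S *ᵥ w) ∘ Sum.inr) ⬝ᵥ P₂⁻¹ *ᵥ (x - (S *ᵥ w) ∘ Sum.inr) + r (x, u, w) :=
    fun x u w ↦ by
      simp [b, X, W, toQuadraticForm', toLinearMap₂'_apply', LinearMap.funLeft]
  obtain ⟨ω, hω, h⟩ := QuadraticForm.exists_convexCombination_nonneg a b (by
    rintro ⟨x, u, w⟩
    rw [ha, hb, hr]
    rcases le_total ((x - (S *ᵥ w) ∘ Sum.inl) ⬝ᵥ P₁⁻¹ *ᵥ (x - (S *ᵥ w) ∘ Sum.inl))
      ((x - (S *ᵥ w) ∘ Sum.inr) ⬝ᵥ P₂⁻¹ *ᵥ (x - (S *ᵥ w) ∘ Sum.inr)) with hle | hle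
    · exact .inr (hKB.nonneg_add hP₁ hP₂ hS x u w hle le_rfl)
    · exact .inl (hKB.nonneg_add hP₁ hP₂ hS x u w le_rfl hle))
  refine ⟨ω, hω, fun x u w ↦ ?_⟩
  have := h (x, u, w)
  rw [ha, hb, hr] at this
  linarith

theorem Matrix.toBlocks₁₁_mulVec {d : ℕ} (S : Matrix (Fin d ⊕ Fin d) (Fin d ⊕ Fin d) ℝ)
    (u : Fin d → ℝ) : (S *ᵥ Sum.elim u 0) ∘ Sum.inl = S.toBlocks₁₁ *ᵥ u := by
  ext i
  simp [mulVec, dotProduct, toBlocks₁₁]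

theorem Matrix.toBlocks₂₂_mulVec {d : ℕ} (S : Matrix (Fin d ⊕ Fin d) (Fin d ⊕ Fin d) ℝ)
    (u : Fin d → ℝ) : (S *ᵥ Sum.elim 0 u) ∘ Sum.inr = S.toBlocks₂₂ *ᵥ u := by
  ext i
  simp [mulVec, dotProduct, toBlocks₂₂]

theorem Matrix.PosDef.dotProduct_inv_mulVec_smul {n : Type*} [Fintype n] [DecidableEq n]
    {P : Matrix n n ℝ} (hP : P.PosDef) (s : ℝ) (v : n → ℝ) :
    (s • P *ᵥ v) ⬝ᵥ P⁻¹ *ᵥ (s • P *ᵥ v) = s ^ 2 * (v ⬝ᵥ P *ᵥ v) := by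
  rw [mulVec_smul, mulVec_mulVec, hP.inv_mul, one_mulVec, smul_dotProduct, dotProduct_smul,
    dotProduct_comm]
  simp only [smul_eq_mul]
  ring

theorem Bc_posDef {d : ℕ} {P₁ P₂ : Matrix (Fin d) (Fin d) ℝ} (hP₁ : P₁.PosDef)
    (hP₂ : P₂.PosDef) {S : Matrix (Fin d ⊕ Fin d) (Fin d ⊕ Fin d) ℝ} (hS : S.PosDef) {ω : ℝ}
    (hω₀ : 0 ≤ ω) (hω₁ : ω ≤ 1) : (Bc d P₁ P₂ S ω).PosDef :=
  PosDef.posSemidef_add ((hP₁.posSemidef.smul (inv_nonneg.2 hω₀)).fromBlocks_diag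
    (hP₂.posSemidef.smul (inv_nonneg.2 (sub_nonneg.2 hω₁)))) hS

theorem BF_isHermitian {d : ℕ} {P₁ P₂ : Matrix (Fin d) (Fin d) ℝ} (hP₁ : P₁.PosDef)
    (hP₂ : P₂.PosDef) {S : Matrix (Fin d ⊕ Fin d) (Fin d ⊕ Fin d) ℝ} (hS : S.PosDef) {ω : ℝ}
    (hω₀ : 0 ≤ ω) (hω₁ : ω ≤ 1) : (BF d P₁ P₂ S ω).IsHermitian := by
  unfold BF AF
  split_ifs
  · exact (hP₂.isHermitian.add (hS.isHermitian.submatrix Sum.inr)).inv.inv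
  · exact (hP₁.isHermitian.add (hS.isHermitian.submatrix Sum.inl)).inv.inv
  · simpa using (isHermitian_conjTranspose_mul_mul (Hmat d)
      (Bc_posDef hP₁ hP₂ hS hω₀ hω₁).isHermitian.inv).inv

/-- The minimum over splittings of the stacked estimate is attained, with value `uᵀ B_F(ω) u`. -/
theorem exists_dotProduct_BF_mulVec_eq {d : ℕ} {P₁ P₂ : Matrix (Fin d) (Fin d) ℝ}
    (hP₁ : P₁.PosDef) (hP₂ : P₂.PosDef) {S : Matrix (Fin d ⊕ Fin d) (Fin d ⊕ Fin d) ℝ}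
    (hS : S.PosDef) {ω : ℝ} (hω₀ : 0 ≤ ω) (hω₁ : ω ≤ 1) (u : Fin d → ℝ) :
    ∃ (x : Fin d → ℝ) (w : Fin d ⊕ Fin d → ℝ), x = BF d P₁ P₂ S ω *ᵥ u ∧
      ω * ((x - (S *ᵥ w) ∘ Sum.inl) ⬝ᵥ P₁⁻¹ *ᵥ (x - (S *ᵥ w) ∘ Sum.inl)) +
        (1 - ω) * ((x - (S *ᵥ w) ∘ Sum.inr) ⬝ᵥ P₂⁻¹ *ᵥ (x - (S *ᵥ w) ∘ Sum.inr)) +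
        w ⬝ᵥ S *ᵥ w = u ⬝ᵥ x := by
  rcases hω₀.eq_or_lt with rfl | hω₀'
  · refine ⟨_, Sum.elim 0 u, rfl, ?_⟩
    have hM : (P₂ + S.toBlocks₂₂).PosDef := hP₂.add (hS.submatrix Sum.inr_injective)
    have hu : (Sum.elim 0 u) ⬝ᵥ S *ᵥ Sum.elim 0 u = u ⬝ᵥ S.toBlocks₂₂ *ᵥ u := by
      rw [← toBlocks₂₂_mulVec]
      simp [dotProduct]
    have hB : BF d P₁ P₂ S 0 = P₂ + S.toBlocks₂₂ := by
      rw [BF, AF, if_pos rfl, nonsing_inv_nonsing_inv _ ((isUnit_iff_isUnit_det _).1 hM.isUnit)]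
    have h := hP₂.dotProduct_inv_mulVec_smul 1 u
    rw [one_smul] at h
    rw [hu, hB, toBlocks₂₂_mulVec, add_mulVec, add_sub_cancel_right, h, dotProduct_add]
    ring
  rcases hω₁.eq_or_lt with rfl | hω₁'
  · refine ⟨_, Sum.elim u 0, rfl, ?_⟩
    have hM : (P₁ + S.toBlocks₁₁).PosDef := hP₁.add (hS.submatrix Sum.inl_injective)
    have hu : (Sum.elim u 0) ⬝ᵥ S *ᵥ Sum.elim u 0 = u ⬝ᵥ S.toBlocks₁₁ *ᵥ u := by
      rw [← toBlocks₁₁_mulVec]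
      simp [dotProduct]
    have hB : BF d P₁ P₂ S 1 = P₁ + S.toBlocks₁₁ := by
      rw [BF, AF, if_neg one_ne_zero, if_pos rfl,
        nonsing_inv_nonsing_inv _ ((isUnit_iff_isUnit_det _).1 hM.isUnit)]
    have h := hP₁.dotProduct_inv_mulVec_smul 1 u
    rw [one_smul] at h
    rw [hu, hB, toBlocks₁₁_mulVec, add_mulVec, add_sub_cancel_right, h, dotProduct_add]
    ring
  obtain ⟨x, hx⟩ : ∃ x, x = BF d P₁ P₂ S ω *ᵥ u := ⟨_, rfl⟩
  refine ⟨x, (Bc d P₁ P₂ S ω)⁻¹ *ᵥ Hmat d *ᵥ x, hx, ?_⟩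
  have hBc := Bc_posDef hP₁ hP₂ hS hω₀ hω₁
  set w := (Bc d P₁ P₂ S ω)⁻¹ *ᵥ Hmat d *ᵥ x with hw
  have hBw : Bc d P₁ P₂ S ω *ᵥ w = Hmat d *ᵥ x := by
    rw [hw, mulVec_mulVec, hBc.mul_inv, one_mulVec]
  have hA : ((Hmat d)ᵀ * (Bc d P₁ P₂ S ω)⁻¹ * Hmat d).PosDef := by
    simpa using hBc.inv.conjTranspose_mul_mul_same (Hmat_mulVec_injective d)
  have hwx : w ⬝ᵥ Hmat d *ᵥ x = u ⬝ᵥ x := by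
    have hAx : (Hmat d)ᵀ *ᵥ w = u := by
      rw [hw, mulVec_mulVec, mulVec_mulVec, hx, BF, AF, if_neg hω₀'.ne', if_neg hω₁'.ne,
        mulVec_mulVec, hA.mul_inv, one_mulVec]
    rw [dotProduct_mulVec, ← mulVec_transpose, hAx]
  have hD : fromBlocks (ω⁻¹ • P₁) 0 0 ((1 - ω)⁻¹ • P₂) *ᵥ w = Hmat d *ᵥ x - S *ᵥ w := by
    rw [← hBw, Bc, add_mulVec, add_sub_cancel_right]
  have h₁ : x - (S *ᵥ w) ∘ Sum.inl = ω⁻¹ • P₁ *ᵥ (w ∘ Sum.inl) := by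
    simpa [Hmat_mulVec, fromBlocks_mulVec, smul_mulVec, Pi.sub_comp] using
      (congrArg (· ∘ Sum.inl) hD).symm
  have h₂ : x - (S *ᵥ w) ∘ Sum.inr = (1 - ω)⁻¹ • P₂ *ᵥ (w ∘ Sum.inr) := by
    simpa [Hmat_mulVec, fromBlocks_mulVec, smul_mulVec, Pi.sub_comp] using
      (congrArg (· ∘ Sum.inr) hD).symm
  have hsum := congrArg (w ⬝ᵥ ·) hD
  simp only [dotProduct_fromBlocks_diag_mulVec, dotProduct_sub, hwx, smul_mulVec,
    dotProduct_smul, smul_eq_mul] at hsum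
  rw [h₁, h₂, hP₁.dotProduct_inv_mulVec_smul, hP₂.dotProduct_inv_mulVec_smul]
  have hω₁'' : 1 - ω ≠ 0 := (sub_pos.2 hω₁').ne'
  have e₁ : ω * (ω⁻¹ ^ 2 * (w ∘ Sum.inl ⬝ᵥ P₁ *ᵥ (w ∘ Sum.inl))) =
      ω⁻¹ * (w ∘ Sum.inl ⬝ᵥ P₁ *ᵥ (w ∘ Sum.inl)) := by
    field_simp
  have e₂ : (1 - ω) * ((1 - ω)⁻¹ ^ 2 * (w ∘ Sum.inr ⬝ᵥ P₂ *ᵥ (w ∘ Sum.inr))) =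
      (1 - ω)⁻¹ * (w ∘ Sum.inr ⬝ᵥ P₂ *ᵥ (w ∘ Sum.inr)) := by
    field_simp
  rw [e₁, e₂, hsum]
  ring

/-- every conservative fusion bound dominates some ESCI bound. -/
theorem esci_bound_below_any_conservative (d : ℕ) (hd : 1 ≤ d)
    (P₁ P₂ : Matrix (Fin d) (Fin d) ℝ) (hP₁ : P₁.PosDef) (hP₂ : P₂.PosDef)
    (S : Matrix (Fin d ⊕ Fin d) (Fin d ⊕ Fin d) ℝ) (hS : S.PosDef)
    (K : Matrix (Fin d) (Fin d ⊕ Fin d) ℝ) (B : Matrix (Fin d) (Fin d) ℝ)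
    (hKB : ConsFusion d P₁ P₂ S K B) :
    ∃ ω₁ ∈ Set.Icc (0 : ℝ) 1, (B - BF d P₁ P₂ S ω₁).PosSemidef := by
  obtain ⟨ω, hω, h⟩ := hKB.exists_weight hP₁ hP₂ hS
  refine ⟨ω, hω, .of_dotProduct_mulVec_nonneg ?_ fun u ↦ ?_⟩
  · have hB : B.IsHermitian := by simpa [IsHermitian] using hKB.1.eq
    exact hB.sub (BF_isHermitian hP₁ hP₂ hS hω.1 hω.2)
  · obtain ⟨_, w, rfl, hw⟩ := exists_dotProduct_BF_mulVec_eq hP₁ hP₂ hS hω.1 hω.2 u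
    have h₁ := h (BF d P₁ P₂ S ω *ᵥ u) u w
    rw [star_trivial, sub_mulVec, dotProduct_sub]
    linarith
end
end
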